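/- Fix p ∈ (0,1/2). If a noisy reversible circuit of size s (number of wires/bits) and depth d computes some output bit that, on some input, equals a fixed value with probability at least 51/100, then s ≥ 2^{Ω(d)}; more precisely s ≥ c·(1/(1−2p))^{2d} for a constant c > 0 depending only on the bias 51/100. -/

import Mathlib

open Finset

/-- A noise step: each of the `s` bits is flipped independently with probability `p`. -/
noncomputable def noiseStep {s : ℕ} (p : ℝ) (μ : (Fin s → Bool) → ℝ) :
    (Fin s → Bool) → ℝ :=
  fun y => ∑ x : Fin s → Bool, μ x * ∏ i : Fin s, (if y i = x i then 1 - p else p)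

/-- A reversible computation step: apply a bijection (reversible gate layer) of `{0,1}ˢ`. -/
def gateStep {s : ℕ} (g : Equiv.Perm (Fin s → Bool)) (μ : (Fin s → Bool) → ℝ) :
    (Fin s → Bool) → ℝ :=
  fun y => μ (g.symm y)

/-- Running a noisy reversible circuit on `s` bits: at each time step the bits are first hit
by independent noise (flip probability `p`) and then a reversible layer is applied. -/
noncomputable def runNoisy {s : ℕ} (p : ℝ) :
    List (Equiv.Perm (Fin s → Bool)) → ((Fin s → Bool) → ℝ) → ((Fin s → Bool) → ℝ)
  | [], μ => μ
  | g :: gs, μ => runNoisy p gs (gateStep g (noiseStep p μ))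

/-- The point mass at the input string `x` (all inputs present at time 0). -/
noncomputable def pointMass {s : ℕ} (x : Fin s → Bool) : (Fin s → Bool) → ℝ :=
  fun y => if y = x then 1 else 0

/-- The deficit `log 2 - H(t)` of the entropy of a bit with bias `t`. -/
noncomputable def bitDeficit (t : ℝ) : ℝ := Real.log 2 - Real.binEntropy t

lemma bitDeficit_nonneg (t : ℝ) : 0 ≤ bitDeficit t :=
  sub_nonneg.2 Real.binEntropy_le_log_two

lemma continuous_bitDeficit : Continuous bitDeficit := by
  unfold bitDeficit
  fun_prop

lemma convexOn_bitDeficit : ConvexOn ℝ (Set.Icc 0 1) bitDeficit :=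
  (convexOn_const _ (convex_Icc 0 1)).sub Real.strictConcave_binEntropy.concaveOn

lemma hasSum_bitDeficit {x : ℝ} (hx : |x| < 1) :
    HasSum (fun k : ℕ => x ^ (2 * k + 2) / ((2 * k + 1) * (2 * k + 2)))
      (bitDeficit ((1 + x) / 2)) := by
  have hsq : |x ^ 2| < 1 := by
    rw [abs_pow]
    exact pow_lt_one₀ (abs_nonneg x) hx two_ne_zero
  have hsum := ((Real.hasSum_log_sub_log_of_abs_lt_one hx).mul_left (x / 2)).sub
    ((Real.hasSum_pow_div_log_of_abs_lt_one hsq).mul_left (1 / 2))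
  obtain ⟨hlo, hhi⟩ := abs_lt.1 hx
  have hp : 0 < 1 + x := by linarith
  have hm : 0 < 1 - x := by linarith
  convert! hsum using 1
  · funext k
    have h1 : (2 * k + 1 : ℝ) ≠ 0 := by positivity
    have h2 : (k + 1 : ℝ) ≠ 0 := by positivity
    field_simp
    ring
  · rw [bitDeficit, Real.binEntropy, show 1 - (1 + x) / 2 = (1 - x) / 2 by ring,
      show 1 - x ^ 2 = (1 + x) * (1 - x) by ring, Real.log_mul hp.ne' hm.ne',
      Real.log_inv, Real.log_inv, Real.log_div hp.ne' two_ne_zero,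
      Real.log_div hm.ne' two_ne_zero]
    ring

/-- An inequality between continuous functions on `(-1, 1)` extends to `[-1, 1]`. -/
lemma le_of_forall_abs_lt_one {f g : ℝ → ℝ} (hf : Continuous f) (hg : Continuous g)
    (h : ∀ x, |x| < 1 → f x ≤ g x) {x : ℝ} (hx : x ∈ Set.Icc (-1 : ℝ) 1) : f x ≤ g x := by
  refine le_on_closure (s := Set.Ioo (-1 : ℝ) 1) (fun y hy => h y (abs_lt.2 hy))
    hf.continuousOn hg.continuousOn ?_
  rwa [closure_Ioo (by norm_num)]

/-- Flipping a bit with probability `p` contracts its entropy deficit by `(1 - 2p)²`. -/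
lemma bitDeficit_noise_le {p t : ℝ} (hp : 0 ≤ p) (hp' : p ≤ 1) (ht : t ∈ Set.Icc (0 : ℝ) 1) :
    bitDeficit ((1 - p) * t + p * (1 - t)) ≤ (1 - 2 * p) ^ 2 * bitDeficit t := by
  have hρ : |1 - 2 * p| ≤ 1 := abs_le.2 ⟨by linarith, by linarith⟩
  have key := le_of_forall_abs_lt_one
    (f := fun x => bitDeficit ((1 + (1 - 2 * p) * x) / 2))
    (g := fun x => (1 - 2 * p) ^ 2 * bitDeficit ((1 + x) / 2))
    (continuous_bitDeficit.comp (by fun_prop))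
    (continuous_const.mul (continuous_bitDeficit.comp (by fun_prop)))
    (fun x hx => ?_) (x := 2 * t - 1) ⟨by linarith [ht.1], by linarith [ht.2]⟩
  · convert key using 2 <;> ring_nf
  · have hρx : |(1 - 2 * p) * x| < 1 := by
      rw [abs_mul]
      exact mul_lt_one_of_nonneg_of_lt_one_right hρ (abs_nonneg x) hx
    refine hasSum_le (fun k => ?_) (hasSum_bitDeficit hρx)
      ((hasSum_bitDeficit hx).mul_left ((1 - 2 * p) ^ 2))
    have hpow : ((1 - 2 * p) ^ 2) ^ k ≤ 1 :=
      pow_le_one₀ (sq_nonneg _) ((sq_le_one_iff_abs_le_one _).2 hρ)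
    have hnn : 0 ≤ (1 - 2 * p) ^ 2 * (x ^ (2 * k + 2) / ((2 * k + 1) * (2 * k + 2))) := by
      have : 0 ≤ x ^ (2 * k + 2) := Even.pow_nonneg ⟨k + 1, by ring⟩ x
      positivity
    calc ((1 - 2 * p) * x) ^ (2 * k + 2) / ((2 * k + 1) * (2 * k + 2))
        = ((1 - 2 * p) ^ 2) ^ k *
            ((1 - 2 * p) ^ 2 * (x ^ (2 * k + 2) / ((2 * k + 1) * (2 * k + 2)))) := by
          rw [mul_pow, ← pow_mul]
          ring
      _ ≤ _ := mul_le_of_le_one_left hnn hpow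

lemma sq_div_two_le_bitDeficit {t : ℝ} (ht : t ∈ Set.Icc (0 : ℝ) 1) :
    (2 * t - 1) ^ 2 / 2 ≤ bitDeficit t := by
  have key := le_of_forall_abs_lt_one
    (f := fun x => x ^ 2 / 2) (g := fun x => bitDeficit ((1 + x) / 2))
    (by fun_prop) (continuous_bitDeficit.comp (by fun_prop))
    (fun x hx => ?_) (x := 2 * t - 1) ⟨by linarith [ht.1], by linarith [ht.2]⟩
  · convert key using 2
    ring
  · have := le_hasSum (hasSum_bitDeficit hx) 0 fun k _ => by
      have : 0 ≤ x ^ (2 * k + 2) := Even.pow_nonneg ⟨k + 1, by ring⟩ x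
      positivity
    simpa using this

/-- The homogeneous extension of `bitDeficit` to unnormalised weights `u`, `v`. -/
noncomputable def pairDeficit (u v : ℝ) : ℝ := (u + v) * bitDeficit (u / (u + v))

lemma pairDeficit_nonneg {u v : ℝ} (hu : 0 ≤ u) (hv : 0 ≤ v) : 0 ≤ pairDeficit u v :=
  mul_nonneg (add_nonneg hu hv) (bitDeficit_nonneg _)

lemma pairDeficit_smul (k u v : ℝ) : pairDeficit (k * u) (k * v) = k * pairDeficit u v := by
  rcases eq_or_ne k 0 with rfl | hk
  · simp [pairDeficit]
  · rw [pairDeficit, pairDeficit, ← mul_add, mul_div_mul_left _ _ hk, mul_assoc]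

lemma div_add_mem_Icc {u v : ℝ} (hu : 0 ≤ u) (hv : 0 ≤ v) :
    u / (u + v) ∈ Set.Icc (0 : ℝ) 1 :=
  ⟨by positivity, div_le_one_of_le₀ (by linarith) (by linarith)⟩

lemma mul_log_add_mul_log {u v : ℝ} (hu : 0 ≤ u) (hv : 0 ≤ v) :
    u * Real.log u + v * Real.log v =
      (u + v) * Real.log (u + v) + pairDeficit u v - Real.log 2 * (u + v) := by
  rcases hu.eq_or_lt with rfl | hu
  · rcases eq_or_ne v 0 with rfl | hv'
    · simp [pairDeficit]
    · simp [pairDeficit, bitDeficit]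
      ring
  rcases hv.eq_or_lt with rfl | hv
  · simp [pairDeficit, bitDeficit, hu.ne']
    ring
  have hw : u + v ≠ 0 := by positivity
  rw [pairDeficit, bitDeficit, Real.binEntropy,
    show 1 - u / (u + v) = v / (u + v) by field_simp; ring, Real.log_inv, Real.log_inv,
    Real.log_div hu.ne' hw, Real.log_div hv.ne' hw]
  field_simp
  ring

lemma pairDeficit_sum_le {ι : Type*} (t : Finset ι) {u v : ι → ℝ} (hu : ∀ a ∈ t, 0 ≤ u a)
    (hv : ∀ a ∈ t, 0 ≤ v a) :
    pairDeficit (∑ a ∈ t, u a) (∑ a ∈ t, v a) ≤ ∑ a ∈ t, pairDeficit (u a) (v a) := by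
  have hw : ∀ a ∈ t, 0 ≤ u a + v a := fun a ha => add_nonneg (hu a ha) (hv a ha)
  rcases (sum_nonneg hw).eq_or_lt with h0 | hpos
  · rw [pairDeficit, ← sum_add_distrib, ← h0, zero_mul]
    exact sum_nonneg fun a ha => pairDeficit_nonneg (hu a ha) (hv a ha)
  · have key := convexOn_bitDeficit.map_centerMass_le hw hpos
      (p := fun a => u a / (u a + v a)) fun a ha => div_add_mem_Icc (hu a ha) (hv a ha)
    have hcancel : ∑ a ∈ t, (u a + v a) * (u a / (u a + v a)) = ∑ a ∈ t, u a := by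
      refine sum_congr rfl fun a ha => mul_div_cancel_of_imp' fun h => ?_
      linarith [hu a ha, hv a ha]
    simp only [centerMass, smul_eq_mul, Function.comp_apply, hcancel] at key
    rw [inv_mul_eq_div, inv_mul_eq_div, le_div_iff₀ hpos] at key
    rw [pairDeficit, ← sum_add_distrib, mul_comm]
    exact key

lemma pairDeficit_noise_le {p u v : ℝ} (hp : 0 ≤ p) (hp' : p ≤ 1) (hu : 0 ≤ u) (hv : 0 ≤ v) :
    pairDeficit ((1 - p) * u + p * v) (p * u + (1 - p) * v) ≤
      (1 - 2 * p) ^ 2 * pairDeficit u v := by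
  have hw : (1 - p) * u + p * v + (p * u + (1 - p) * v) = u + v := by ring
  rw [pairDeficit, pairDeficit, hw, mul_left_comm]
  rcases (add_nonneg hu hv).eq_or_lt with h0 | hpos
  · simp [← h0]
  · refine mul_le_mul_of_nonneg_left ?_ hpos.le
    have hbias : ((1 - p) * u + p * v) / (u + v) =
        (1 - p) * (u / (u + v)) + p * (1 - u / (u + v)) := by
      have hw0 := hpos.ne'
      field_simp
      ring
    rw [hbias]
    exact bitDeficit_noise_le hp hp' (div_add_mem_Icc hu hv)

lemma sum_eq_sum_insertNth {n : ℕ} (i : Fin (n + 1)) (F : (Fin (n + 1) → Bool) → ℝ) :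
    ∑ y, F y = ∑ a : Fin n → Bool,
      (F (i.insertNth (α := fun _ => Bool) false a) +
        F (i.insertNth (α := fun _ => Bool) true a)) := by
  rw [← (Fin.insertNthEquiv (fun _ => Bool) i).sum_comp, Fintype.sum_prod_type_right]
  simp [add_comm, Fin.insertNthEquiv]

/-- The distribution of all bits but the `i`-th. -/
def marginal {n : ℕ} (i : Fin (n + 1)) (μ : (Fin (n + 1) → Bool) → ℝ) : (Fin n → Bool) → ℝ :=
  fun a => μ (i.insertNth (α := fun _ => Bool) false a) +
    μ (i.insertNth (α := fun _ => Bool) true a)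

/-- The relative entropy of a distribution on `s` bits with respect to the uniform one. -/
noncomputable def entropyDeficit {s : ℕ} (μ : (Fin s → Bool) → ℝ) : ℝ :=
  ∑ y, μ y * Real.log (μ y) + s * Real.log 2 * ∑ y, μ y

lemma entropyDeficit_eq_marginal_add {n : ℕ} (i : Fin (n + 1))
    {μ : (Fin (n + 1) → Bool) → ℝ} (hμ : ∀ y, 0 ≤ μ y) :
    entropyDeficit μ = entropyDeficit (marginal i μ) +
      ∑ a, pairDeficit (μ (i.insertNth (α := fun _ => Bool) false a))
        (μ (i.insertNth (α := fun _ => Bool) true a)) := by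
  rw [entropyDeficit, entropyDeficit, sum_eq_sum_insertNth i μ,
    sum_eq_sum_insertNth i fun y => μ y * Real.log (μ y)]
  simp only [mul_log_add_mul_log (hμ _) (hμ _), marginal, sum_sub_distrib, sum_add_distrib,
    ← mul_sum]
  push_cast
  ring

/-- The probability that noise turns `x` into `y`. -/
noncomputable def noiseKernel {s : ℕ} (p : ℝ) (x y : Fin s → Bool) : ℝ :=
  ∏ i, if y i = x i then 1 - p else p

lemma noiseKernel_nonneg {s : ℕ} {p : ℝ} (hp : 0 ≤ p) (hp' : p ≤ 1) (x y : Fin s → Bool) :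
    0 ≤ noiseKernel p x y :=
  prod_nonneg fun _ _ => by split_ifs <;> linarith

lemma noiseKernel_insertNth {n : ℕ} (i : Fin (n + 1)) (p : ℝ) (b c : Bool)
    (x y : Fin n → Bool) :
    noiseKernel p (i.insertNth (α := fun _ => Bool) b x)
        (i.insertNth (α := fun _ => Bool) c y) =
      (if c = b then 1 - p else p) * noiseKernel p x y := by
  simp [noiseKernel, Fin.prod_univ_succAbove _ i]

lemma sum_noiseKernel {s : ℕ} (p : ℝ) (x : Fin s → Bool) : ∑ y, noiseKernel p x y = 1 := by
  have h := Finset.prod_univ_sum (fun _ : Fin s => (univ : Finset Bool))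
    (fun i b => if b = x i then 1 - p else p)
  rw [Fintype.piFinset_univ] at h
  simp only [noiseKernel, ← h]
  refine prod_eq_one fun i _ => ?_
  cases x i <;> simp

lemma noiseStep_apply {s : ℕ} (p : ℝ) (μ : (Fin s → Bool) → ℝ) (y : Fin s → Bool) :
    noiseStep p μ y = ∑ x, μ x * noiseKernel p x y := rfl

lemma noiseStep_nonneg {s : ℕ} {p : ℝ} (hp : 0 ≤ p) (hp' : p ≤ 1) {μ : (Fin s → Bool) → ℝ}
    (hμ : ∀ y, 0 ≤ μ y) (y : Fin s → Bool) : 0 ≤ noiseStep p μ y :=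
  sum_nonneg fun x _ => mul_nonneg (hμ x) (noiseKernel_nonneg hp hp' x y)

lemma sum_noiseStep {s : ℕ} (p : ℝ) (μ : (Fin s → Bool) → ℝ) :
    ∑ y, noiseStep p μ y = ∑ y, μ y := by
  simp only [noiseStep_apply]
  rw [sum_comm]
  simp [← mul_sum, sum_noiseKernel]

lemma noiseStep_insertNth {n : ℕ} (i : Fin (n + 1)) (p : ℝ) (μ : (Fin (n + 1) → Bool) → ℝ)
    (c : Bool) (y : Fin n → Bool) :
    noiseStep p μ (i.insertNth (α := fun _ => Bool) c y) =
      ∑ a, noiseKernel p a y *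
        ((if c = false then 1 - p else p) * μ (i.insertNth (α := fun _ => Bool) false a) +
          (if c = true then 1 - p else p) * μ (i.insertNth (α := fun _ => Bool) true a)) := by
  rw [noiseStep_apply, sum_eq_sum_insertNth i]
  refine sum_congr rfl fun a _ => ?_
  rw [noiseKernel_insertNth, noiseKernel_insertNth]
  ring

lemma marginal_noiseStep {n : ℕ} (i : Fin (n + 1)) (p : ℝ) (μ : (Fin (n + 1) → Bool) → ℝ) :
    marginal i (noiseStep p μ) = noiseStep p (marginal i μ) := by
  funext y
  rw [marginal, noiseStep_insertNth, noiseStep_insertNth, noiseStep_apply, ← sum_add_distrib]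
  refine sum_congr rfl fun a _ => ?_
  simp only [marginal, reduceCtorEq, if_true, if_false]
  ring

lemma sum_marginal {n : ℕ} (i : Fin (n + 1)) (μ : (Fin (n + 1) → Bool) → ℝ) :
    ∑ a, marginal i μ a = ∑ y, μ y :=
  (sum_eq_sum_insertNth i μ).symm

lemma marginal_nonneg {n : ℕ} (i : Fin (n + 1)) {μ : (Fin (n + 1) → Bool) → ℝ}
    (hμ : ∀ y, 0 ≤ μ y) (a : Fin n → Bool) : 0 ≤ marginal i μ a :=
  add_nonneg (hμ _) (hμ _)

lemma entropyDeficit_eq_zero_of_isEmpty {μ : (Fin 0 → Bool) → ℝ} (h : ∑ y, μ y = 1) :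
    entropyDeficit μ = 0 := by
  rw [Fintype.sum_unique] at h
  simp [entropyDeficit, h]

lemma entropyDeficit_nonneg {s : ℕ} {μ : (Fin s → Bool) → ℝ} (hμ : ∀ y, 0 ≤ μ y)
    (hsum : ∑ y, μ y = 1) : 0 ≤ entropyDeficit μ := by
  induction s with
  | zero => exact (entropyDeficit_eq_zero_of_isEmpty hsum).ge
  | succ n ih =>
    rw [entropyDeficit_eq_marginal_add 0 hμ]
    exact add_nonneg (ih (marginal_nonneg 0 hμ) ((sum_marginal 0 μ).trans hsum))
      (sum_nonneg fun a _ => pairDeficit_nonneg (hμ _) (hμ _))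

/-- A noise step contracts the entropy deficit by `(1 - 2p)²`. -/
lemma entropyDeficit_noiseStep_le {s : ℕ} {p : ℝ} (hp : 0 ≤ p) (hp' : p ≤ 1)
    {μ : (Fin s → Bool) → ℝ} (hμ : ∀ y, 0 ≤ μ y) (hsum : ∑ y, μ y = 1) :
    entropyDeficit (noiseStep p μ) ≤ (1 - 2 * p) ^ 2 * entropyDeficit μ := by
  induction s with
  | zero =>
    rw [entropyDeficit_eq_zero_of_isEmpty hsum,
      entropyDeficit_eq_zero_of_isEmpty ((sum_noiseStep p μ).trans hsum), mul_zero]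
  | succ n ih =>
    rw [entropyDeficit_eq_marginal_add 0 hμ,
      entropyDeficit_eq_marginal_add 0 (noiseStep_nonneg hp hp' hμ), marginal_noiseStep, mul_add]
    refine add_le_add (ih (marginal_nonneg 0 hμ) ((sum_marginal 0 μ).trans hsum)) ?_
    set u : (Fin n → Bool) → ℝ :=
      fun a => μ ((0 : Fin (n + 1)).insertNth (α := fun _ => Bool) false a) with hu
    set v : (Fin n → Bool) → ℝ :=
      fun a => μ ((0 : Fin (n + 1)).insertNth (α := fun _ => Bool) true a) with hv
    have hu0 : ∀ a, 0 ≤ u a := fun a => hμ _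
    have hv0 : ∀ a, 0 ≤ v a := fun a => hμ _
    have hq : 0 ≤ 1 - p := by linarith
    calc ∑ y, pairDeficit
          (noiseStep p μ ((0 : Fin (n + 1)).insertNth (α := fun _ => Bool) false y))
          (noiseStep p μ ((0 : Fin (n + 1)).insertNth (α := fun _ => Bool) true y))
        = ∑ y, pairDeficit (∑ a, noiseKernel p a y * ((1 - p) * u a + p * v a))
            (∑ a, noiseKernel p a y * (p * u a + (1 - p) * v a)) := by
          simp only [noiseStep_insertNth, hu, hv, reduceCtorEq, if_true, if_false]
      _ ≤ ∑ y, ∑ a, noiseKernel p a y *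
            pairDeficit ((1 - p) * u a + p * v a) (p * u a + (1 - p) * v a) := by
          refine sum_le_sum fun y _ => ?_
          simp only [← pairDeficit_smul]
          refine pairDeficit_sum_le _ (fun a _ => ?_) fun a _ => ?_
          · exact mul_nonneg (noiseKernel_nonneg hp hp' a y)
              (add_nonneg (mul_nonneg hq (hu0 a)) (mul_nonneg hp (hv0 a)))
          · exact mul_nonneg (noiseKernel_nonneg hp hp' a y)
              (add_nonneg (mul_nonneg hp (hu0 a)) (mul_nonneg hq (hv0 a)))
      _ = ∑ a, pairDeficit ((1 - p) * u a + p * v a) (p * u a + (1 - p) * v a) := by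
          rw [sum_comm]
          simp [← sum_mul, sum_noiseKernel]
      _ ≤ (1 - 2 * p) ^ 2 * ∑ a, pairDeficit (u a) (v a) := by
          rw [mul_sum]
          exact sum_le_sum fun a _ => pairDeficit_noise_le hp hp' (hu0 a) (hv0 a)

lemma sum_gateStep {s : ℕ} (g : Equiv.Perm (Fin s → Bool)) (μ : (Fin s → Bool) → ℝ) :
    ∑ y, gateStep g μ y = ∑ y, μ y :=
  g.symm.sum_comp μ

lemma entropyDeficit_gateStep {s : ℕ} (g : Equiv.Perm (Fin s → Bool))
    (μ : (Fin s → Bool) → ℝ) : entropyDeficit (gateStep g μ) = entropyDeficit μ := by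
  rw [entropyDeficit, entropyDeficit, sum_gateStep]
  congr 1
  exact g.symm.sum_comp fun y => μ y * Real.log (μ y)

lemma runNoisy_nonneg {s : ℕ} {p : ℝ} (hp : 0 ≤ p) (hp' : p ≤ 1)
    (gates : List (Equiv.Perm (Fin s → Bool))) {μ : (Fin s → Bool) → ℝ} (hμ : ∀ y, 0 ≤ μ y)
    (y : Fin s → Bool) : 0 ≤ runNoisy p gates μ y := by
  induction gates generalizing μ with
  | nil => exact hμ y
  | cons g gs ih => exact ih fun z => noiseStep_nonneg hp hp' hμ _

lemma sum_runNoisy {s : ℕ} (p : ℝ) (gates : List (Equiv.Perm (Fin s → Bool)))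
    (μ : (Fin s → Bool) → ℝ) : ∑ y, runNoisy p gates μ y = ∑ y, μ y := by
  induction gates generalizing μ with
  | nil => rfl
  | cons g gs ih => rw [runNoisy, ih, sum_gateStep, sum_noiseStep]

lemma entropyDeficit_runNoisy_le {s : ℕ} {p : ℝ} (hp : 0 ≤ p) (hp' : p ≤ 1)
    (gates : List (Equiv.Perm (Fin s → Bool))) {μ : (Fin s → Bool) → ℝ} (hμ : ∀ y, 0 ≤ μ y)
    (hsum : ∑ y, μ y = 1) :
    entropyDeficit (runNoisy p gates μ) ≤
      (1 - 2 * p) ^ (2 * gates.length) * entropyDeficit μ := by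
  induction gates generalizing μ with
  | nil => simp [runNoisy]
  | cons g gs ih =>
    calc entropyDeficit (runNoisy p gs (gateStep g (noiseStep p μ)))
        ≤ (1 - 2 * p) ^ (2 * gs.length) * entropyDeficit (gateStep g (noiseStep p μ)) :=
          ih (fun z => noiseStep_nonneg hp hp' hμ _)
            (by rw [sum_gateStep, sum_noiseStep, hsum])
      _ ≤ (1 - 2 * p) ^ (2 * gs.length) * ((1 - 2 * p) ^ 2 * entropyDeficit μ) := by
          rw [entropyDeficit_gateStep]
          exact mul_le_mul_of_nonneg_left (entropyDeficit_noiseStep_le hp hp' hμ hsum)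
            (Even.pow_nonneg (even_two_mul _) _)
      _ = (1 - 2 * p) ^ (2 * (g :: gs).length) * entropyDeficit μ := by
          rw [List.length_cons]
          ring

lemma sum_pointMass {s : ℕ} (x : Fin s → Bool) : ∑ y, pointMass x y = 1 := by
  simp [pointMass]

lemma entropyDeficit_pointMass {s : ℕ} (x : Fin s → Bool) :
    entropyDeficit (pointMass x) = s * Real.log 2 := by
  rw [entropyDeficit, sum_pointMass]
  simp [pointMass]

/-- A single bit carries no more information than the whole string. -/
lemma bias_sq_le_entropyDeficit {s : ℕ} {μ : (Fin s → Bool) → ℝ} (hμ : ∀ y, 0 ≤ μ y)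
    (hsum : ∑ y, μ y = 1) (i : Fin s) (b : Bool) :
    (2 * ∑ y ∈ univ.filter (fun y : Fin s → Bool => y i = b), μ y - 1) ^ 2 / 2 ≤
      entropyDeficit μ := by
  obtain _ | n := s
  · exact i.elim0
  set U := ∑ a, μ (i.insertNth (α := fun _ => Bool) false a) with hU
  set V := ∑ a, μ (i.insertNth (α := fun _ => Bool) true a) with hV
  have hUV : U + V = 1 := by rw [hU, hV, ← sum_add_distrib, ← sum_eq_sum_insertNth, hsum]
  have hU0 : 0 ≤ U := sum_nonneg fun a _ => hμ _
  have hV0 : 0 ≤ V := sum_nonneg fun a _ => hμ _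
  have hbias : (2 * ∑ y ∈ univ.filter (fun y : Fin (n + 1) → Bool => y i = b), μ y - 1) ^ 2 =
      (2 * U - 1) ^ 2 := by
    rw [sum_filter, sum_eq_sum_insertNth i]
    cases b
    · simp [← hU]
    · simp only [Fin.insertNth_apply_same, reduceCtorEq, if_true, if_false, zero_add, ← hV]
      rw [show V = 1 - U by linarith]
      ring
  calc _ = (2 * U - 1) ^ 2 / 2 := by rw [hbias]
    _ ≤ bitDeficit U := sq_div_two_le_bitDeficit ⟨hU0, by linarith⟩
    _ = pairDeficit U V := by rw [pairDeficit, hUV, div_one, one_mul]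
    _ ≤ ∑ a, pairDeficit (μ (i.insertNth (α := fun _ => Bool) false a))
          (μ (i.insertNth (α := fun _ => Bool) true a)) :=
        pairDeficit_sum_le _ (fun a _ => hμ _) fun a _ => hμ _
    _ ≤ entropyDeficit μ := by
        rw [entropyDeficit_eq_marginal_add i hμ]
        exact le_add_of_nonneg_left (entropyDeficit_nonneg (marginal_nonneg i hμ)
          ((sum_marginal i μ).trans hsum))

/-- If a noisy reversible circuit of size `s` (number of wires/bits) and depth `d` has some
output bit that, on some input, equals a fixed value with probability at least `51/100`,
then `s ≥ c·(1/(1−2p))^{2d}` for a constant `c > 0` depending only on the bias `51/100`;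
in particular `s = 2^{Ω(d)}`. -/
theorem noisy_reversible_lower_bound :
    ∃ c : ℝ, 0 < c ∧
      ∀ (p : ℝ), 0 < p → p < 1 / 2 →
      ∀ (s : ℕ) (gates : List (Equiv.Perm (Fin s → Bool))) (x : Fin s → Bool) (i : Fin s)
        (b : Bool),
        (51 : ℝ) / 100 ≤
            ∑ y ∈ univ.filter (fun y : Fin s → Bool => y i = b),
              runNoisy p gates (pointMass x) y →
        (s : ℝ) ≥ c * (1 / (1 - 2 * p)) ^ (2 * gates.length) := by
  refine ⟨1 / 5000, by norm_num, fun p hp hp' s gates x i b hbias => ?_⟩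
  have hx0 : ∀ y, 0 ≤ pointMass x y := fun y => by
    unfold pointMass
    split_ifs <;> norm_num
  have hinfo := (bias_sq_le_entropyDeficit (runNoisy_nonneg hp.le (by linarith) gates hx0)
    ((sum_runNoisy p gates _).trans (sum_pointMass x)) i b).trans
    (entropyDeficit_runNoisy_le hp.le (by linarith) gates hx0 (sum_pointMass x))
  rw [entropyDeficit_pointMass] at hinfo
  have hρ : 0 < (1 - 2 * p) ^ (2 * gates.length) := pow_pos (by linarith) _
  have hlog : (s : ℝ) * Real.log 2 ≤ s :=
    mul_le_of_le_one_right (Nat.cast_nonneg s) (by linarith [Real.log_two_lt_d9])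
  have hbound := mul_le_mul_of_nonneg_left hlog hρ.le
  rw [ge_iff_le, one_div_pow, mul_one_div, div_le_iff₀ hρ]
  nlinarith
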